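/- arXiv:0706.2906 — 2 statements merged into one kernel-verified Lean document; each statement's English description precedes it below -/
import Mathlib

section
/- Let X : Ω → 𝒳, U : Ω → 𝒰, T : Ω → 𝒯, Y : Ω → 𝒴 be random variables on a probability space taking values in nonempty finite types, and suppose Y and ⟨X, U⟩ are conditionally independent given T. Then I[⟨X, T⟩ : Y | U] ≤ I[T : Y]. (This is the multiple-access cut-set manipulation: the rate of information transfer from the sources through the relays is bounded by the unconditional mutual information between the relay transmit signals and the received signal.) -/
open MeasureTheory ProbabilityTheory Filter
open scoped ProbabilityTheory

/-- Shannon entropy (natural log) of a random variable with values in a finite type. -/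
noncomputable def entropy {Ω : Type*} [MeasurableSpace Ω] (Pr : Measure Ω)
    {S : Type*} [Fintype S] (X : Ω → S) : ℝ :=
  ∑ s : S, Real.negMulLog ((Pr (X ⁻¹' {s})).toReal)

/-- Conditional entropy `H[X | Y] = H[⟨X, Y⟩] - H[Y]`. -/
noncomputable def condEntropy {Ω : Type*} [MeasurableSpace Ω] (Pr : Measure Ω)
    {S T : Type*} [Fintype S] [Fintype T] (X : Ω → S) (Y : Ω → T) : ℝ :=
  entropy Pr (fun ω => (X ω, Y ω)) - entropy Pr Y

/-- Mutual information `I[X : Y] = H[X] + H[Y] - H[⟨X, Y⟩]`. -/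
noncomputable def mutualInfo {Ω : Type*} [MeasurableSpace Ω] (Pr : Measure Ω)
    {S T : Type*} [Fintype S] [Fintype T] (X : Ω → S) (Y : Ω → T) : ℝ :=
  entropy Pr X + entropy Pr Y - entropy Pr (fun ω => (X ω, Y ω))

/-- Conditional mutual information
`I[X : Y | Z] = H[⟨X, Z⟩] + H[⟨Y, Z⟩] - H[⟨X, Y, Z⟩] - H[Z]`. -/
noncomputable def condMutualInfo {Ω : Type*} [MeasurableSpace Ω] (Pr : Measure Ω)
    {S T V : Type*} [Fintype S] [Fintype T] [Fintype V]
    (X : Ω → S) (Y : Ω → T) (Z : Ω → V) : ℝ :=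
  entropy Pr (fun ω => (X ω, Z ω)) + entropy Pr (fun ω => (Y ω, Z ω))
    - entropy Pr (fun ω => (X ω, Y ω, Z ω)) - entropy Pr Z

theorem sum_measureReal_comp_mul {Ω S A : Type*} [MeasurableSpace Ω] (Pr : Measure Ω)
    [IsFiniteMeasure Pr] [Fintype S] [MeasurableSpace S] [MeasurableSingletonClass S] [Fintype A]
    {Z : Ω → S} (hZ : Measurable Z) (f : S → A) (g : A → ℝ) :
    ∑ a, Pr.real ((fun ω => f (Z ω)) ⁻¹' {a}) * g a = ∑ s, Pr.real (Z ⁻¹' {s}) * g (f s) := by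
  classical
  rw [← Finset.sum_fiberwise Finset.univ f]
  refine Finset.sum_congr rfl fun a _ => ?_
  have h : (fun ω => f (Z ω)) ⁻¹' {a} = Z ⁻¹' ↑({s | f s = a} : Finset S) := by
    ext ω
    simp
  rw [h, ← sum_measureReal_preimage_singleton _ fun s _ => hZ (measurableSet_singleton s),
    Finset.sum_mul]
  refine Finset.sum_congr rfl fun s hs => ?_
  rw [(Finset.mem_filter.mp hs).2]

theorem sum_measureReal_preimage_singleton_eq_one {Ω S : Type*} [MeasurableSpace Ω]
    (Pr : Measure Ω) [IsProbabilityMeasure Pr] [Fintype S] [MeasurableSpace S]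
    [MeasurableSingletonClass S] {Z : Ω → S} (hZ : Measurable Z) :
    ∑ s, Pr.real (Z ⁻¹' {s}) = 1 := by
  rw [sum_measureReal_preimage_singleton _ fun s _ => hZ (measurableSet_singleton s)]
  simp

/-- The entropy of a function of `Z`, as an expectation over the values of `Z`. -/
theorem entropy_comp {Ω S A : Type*} [MeasurableSpace Ω] (Pr : Measure Ω)
    [IsFiniteMeasure Pr] [Fintype S] [MeasurableSpace S] [MeasurableSingletonClass S] [Fintype A]
    {Z : Ω → S} (hZ : Measurable Z) (f : S → A) :
    entropy Pr (fun ω => f (Z ω)) =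
      ∑ s, Pr.real (Z ⁻¹' {s}) * -Real.log (Pr.real ((fun ω => f (Z ω)) ⁻¹' {f s})) := by
  rw [← sum_measureReal_comp_mul Pr hZ f fun a =>
    -Real.log (Pr.real ((fun ω => f (Z ω)) ⁻¹' {a}))]
  refine Finset.sum_congr rfl fun a _ => ?_
  simp only [Real.negMulLog, Measure.real]
  ring

theorem sub_mul_le_mul_log_sub {p q r : ℝ} (hp : 0 ≤ p) (hpq : p ≤ q) (hpr : p ≤ r) :
    p - q * r ≤ p * -Real.log q + p * -Real.log r - p * -Real.log p := by
  rcases hp.eq_or_lt with rfl | hp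
  · simpa using mul_nonneg hpq hpr
  have hq := hp.trans_le hpq
  have hr := hp.trans_le hpr
  have h := Real.log_le_sub_one_of_pos (div_pos (mul_pos hq hr) hp)
  rw [Real.log_div (mul_pos hq hr).ne' hp.ne', Real.log_mul hq.ne' hr.ne'] at h
  have h' := mul_le_mul_of_nonneg_left h hp.le
  have e : p * (q * r / p - 1) = q * r - p := by
    field_simp
  linarith

/-- Subadditivity of entropy. -/
theorem entropy_prod_le_add {Ω S T : Type*} [MeasurableSpace Ω] (Pr : Measure Ω)
    [IsProbabilityMeasure Pr] [Fintype S] [MeasurableSpace S] [MeasurableSingletonClass S]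
    [Fintype T] [MeasurableSpace T] [MeasurableSingletonClass T]
    {X : Ω → S} {Y : Ω → T} (hX : Measurable X) (hY : Measurable Y) :
    entropy Pr (fun ω => (X ω, Y ω)) ≤ entropy Pr X + entropy Pr Y := by
  have hZ : Measurable fun ω => (X ω, Y ω) := hX.prodMk hY
  have hs : ∑ s : S × T, (Pr.real ((fun ω => (X ω, Y ω)) ⁻¹' {s}) -
      Pr.real (X ⁻¹' {s.1}) * Pr.real (Y ⁻¹' {s.2})) = 0 := by
    rw [Finset.sum_sub_distrib, sum_measureReal_preimage_singleton_eq_one Pr hZ,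
      Fintype.sum_prod_type]
    simp [← Finset.mul_sum, sum_measureReal_preimage_singleton_eq_one Pr hX,
      sum_measureReal_preimage_singleton_eq_one Pr hY]
  have h : ∑ s : S × T, (Pr.real ((fun ω => (X ω, Y ω)) ⁻¹' {s}) -
      Pr.real (X ⁻¹' {s.1}) * Pr.real (Y ⁻¹' {s.2})) ≤ _ :=
    Finset.sum_le_sum fun s _ => sub_mul_le_mul_log_sub measureReal_nonneg
      (measureReal_mono fun ω hω => congrArg Prod.fst hω)
      (measureReal_mono fun ω hω => congrArg Prod.snd hω)
  have h1 := entropy_comp Pr hZ Prod.fst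
  have h2 := entropy_comp Pr hZ Prod.snd
  have h3 := entropy_comp Pr hZ id
  simp only [id] at h1 h2 h3
  rw [hs, Finset.sum_sub_distrib, Finset.sum_add_distrib, ← h1, ← h2, ← h3] at h
  linarith

theorem mul_log_add_of_mul_eq {p q a b : ℝ} (hp : 0 ≤ p) (hq : p ≤ q) (ha : p ≤ a) (hb : p ≤ b)
    (h : p * q = a * b) :
    p * -Real.log p + p * -Real.log q = p * -Real.log a + p * -Real.log b := by
  rcases hp.eq_or_lt with rfl | hp
  · simp
  have hl := congrArg Real.log h
  rw [Real.log_mul hp.ne' (hp.trans_le hq).ne',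
    Real.log_mul (hp.trans_le ha).ne' (hp.trans_le hb).ne'] at hl
  linear_combination -p * hl

/-- The entropy identity for `Y` and `⟨X, U⟩` conditionally independent given `T`. -/
theorem entropy_add_entropy_of_condIndep {Ω : Type*} [MeasurableSpace Ω]
    (Pr : Measure Ω) [IsFiniteMeasure Pr] {𝒳 𝒰 𝒯 𝒴 : Type*}
    [Fintype 𝒳] [MeasurableSpace 𝒳] [MeasurableSingletonClass 𝒳]
    [Fintype 𝒰] [MeasurableSpace 𝒰] [MeasurableSingletonClass 𝒰]
    [Fintype 𝒯] [MeasurableSpace 𝒯] [MeasurableSingletonClass 𝒯]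
    [Fintype 𝒴] [MeasurableSpace 𝒴] [MeasurableSingletonClass 𝒴]
    {X : Ω → 𝒳} {U : Ω → 𝒰} {T : Ω → 𝒯} {Y : Ω → 𝒴}
    (hX : Measurable X) (hU : Measurable U) (hT : Measurable T) (hY : Measurable Y)
    (hci : ∀ (y : 𝒴) (x : 𝒳) (u : 𝒰) (t : 𝒯), 0 < Pr (T ⁻¹' {t}) →
      Pr[|T ⁻¹' {t}] {ω | Y ω = y ∧ X ω = x ∧ U ω = u} =
        Pr[|T ⁻¹' {t}] {ω | Y ω = y} * Pr[|T ⁻¹' {t}] {ω | X ω = x ∧ U ω = u}) :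
    entropy Pr (fun ω => ((X ω, T ω), Y ω, U ω)) + entropy Pr T =
      entropy Pr (fun ω => ((X ω, T ω), U ω)) + entropy Pr (fun ω => (T ω, Y ω)) := by
  have hZ : Measurable fun ω => ((X ω, T ω), Y ω, U ω) :=
    (hX.prodMk hT).prodMk (hY.prodMk hU)
  have h1 := entropy_comp Pr hZ id
  have h2 := entropy_comp Pr hZ fun s => s.1.2
  have h3 := entropy_comp Pr hZ fun s => (s.1, s.2.2)
  have h4 := entropy_comp Pr hZ fun s => (s.1.2, s.2.1)
  simp only [id] at h1 h2 h3 h4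
  rw [h1, h2, h3, h4, ← Finset.sum_add_distrib, ← Finset.sum_add_distrib]
  refine Finset.sum_congr rfl fun s _ => ?_
  obtain ⟨⟨x, t⟩, y, u⟩ := s
  have hle : Pr.real ((fun ω => ((X ω, T ω), Y ω, U ω)) ⁻¹' {((x, t), y, u)}) ≤
      Pr.real (T ⁻¹' {t}) := measureReal_mono fun ω hω => congrArg (fun s : (𝒳 × 𝒯) × 𝒴 × 𝒰 => s.1.2) hω
  refine mul_log_add_of_mul_eq measureReal_nonneg hle
    (measureReal_mono fun ω hω => congrArg (fun s : (𝒳 × 𝒯) × 𝒴 × 𝒰 => (s.1, s.2.2)) hω)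
    (measureReal_mono fun ω hω => congrArg (fun s : (𝒳 × 𝒯) × 𝒴 × 𝒰 => (s.1.2, s.2.1)) hω) ?_
  have e1 : (fun ω => ((X ω, T ω), Y ω, U ω)) ⁻¹' {((x, t), y, u)} =
      T ⁻¹' {t} ∩ {ω | Y ω = y ∧ X ω = x ∧ U ω = u} := by
    ext ω
    simp
    tauto
  have e2 : (fun ω => ((X ω, T ω), U ω)) ⁻¹' {((x, t), u)} =
      T ⁻¹' {t} ∩ {ω | X ω = x ∧ U ω = u} := by
    ext ω
    simp
    tauto
  have e3 : (fun ω => (T ω, Y ω)) ⁻¹' {(t, y)} = T ⁻¹' {t} ∩ {ω | Y ω = y} := by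
    ext ω
    simp
  rw [e1, e2, e3]
  rcases eq_or_ne (Pr.real (T ⁻¹' {t})) 0 with h0 | h0
  · have hz : Pr.real (T ⁻¹' {t} ∩ {ω | Y ω = y}) = 0 :=
      le_antisymm (h0 ▸ measureReal_mono Set.inter_subset_left) measureReal_nonneg
    rw [h0, hz, mul_zero, mul_zero]
  have hpos : 0 < Pr (T ⁻¹' {t}) := pos_iff_ne_zero.mpr fun h => h0 (by simp [Measure.real, h])
  have h := congrArg ENNReal.toReal (hci y x u t hpos)
  have hm := hT (measurableSet_singleton t)
  simp only [cond_apply hm, ENNReal.toReal_mul, ENNReal.toReal_inv, ← measureReal_def] at h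
  field_simp at h
  linarith

/-- If `Y` and `⟨X, U⟩` are conditionally independent given `T`, then
`I[⟨X, T⟩ : Y | U] ≤ I[T : Y]`. -/
theorem condMutualInfo_le_mutualInfo_of_condIndep {Ω : Type*} [MeasurableSpace Ω]
    (Pr : Measure Ω) [IsProbabilityMeasure Pr]
    {𝒳 𝒰 𝒯 𝒴 : Type*}
    [Fintype 𝒳] [Nonempty 𝒳] [MeasurableSpace 𝒳] [DiscreteMeasurableSpace 𝒳]
    [Fintype 𝒰] [Nonempty 𝒰] [MeasurableSpace 𝒰] [DiscreteMeasurableSpace 𝒰]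
    [Fintype 𝒯] [Nonempty 𝒯] [MeasurableSpace 𝒯] [DiscreteMeasurableSpace 𝒯]
    [Fintype 𝒴] [Nonempty 𝒴] [MeasurableSpace 𝒴] [DiscreteMeasurableSpace 𝒴]
    (X : Ω → 𝒳) (U : Ω → 𝒰) (T : Ω → 𝒯) (Y : Ω → 𝒴)
    (hX : Measurable X) (hU : Measurable U) (hT : Measurable T) (hY : Measurable Y)
    (hci : ∀ (y : 𝒴) (x : 𝒳) (u : 𝒰) (t : 𝒯), 0 < Pr (T ⁻¹' {t}) →
      Pr[|T ⁻¹' {t}] {ω | Y ω = y ∧ X ω = x ∧ U ω = u} =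
        Pr[|T ⁻¹' {t}] {ω | Y ω = y} * Pr[|T ⁻¹' {t}] {ω | X ω = x ∧ U ω = u}) :
    condMutualInfo Pr (fun ω => (X ω, T ω)) Y U ≤ mutualInfo Pr T Y := by
  have h := entropy_add_entropy_of_condIndep Pr hX hU hT hY hci
  have h' := entropy_prod_le_add Pr hY hU
  simp only [condMutualInfo, mutualInfo]
  linarith
end

section
/- Let M ≥ 1, let a > 0 and θ > 0 be real numbers, let (A_K)_{K≥1} be a sequence of M×M complex matrices with A_K → a • I_M entrywise, and let (B_K)_{K≥1} be a sequence of Hermitian positive definite M×M complex matrices with B_K → θ • I_M entrywise. Then det(I_M + (K/M) · A_K A_Kᴴ (B_K + (1/K) I_M)⁻¹) is a positive real number for every K, and (1/2) log det(I_M + (K/M) · A_K A_Kᴴ (B_K + (1/K) I_M)⁻¹) − (M/2) log K → (M/2) log(a²/(M θ)) as K → ∞. (This is the asymptotic evaluation of the achievable rate R₁₂ of the dual channel matching strategy in Theorem 2, with A_K = Â/K and B_K = (1/K) ∑ B̂_k B̂_kᴴ; it shows R₁₂ = (M/2) log K + O(1) almost surely.) -/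
open Matrix Filter
open scoped Topology ComplexOrder

/-- `det (1 + c P C⁻¹)` as a quotient of determinants. -/
theorem det_one_add_smul_mul_inv {n : Type*} [Fintype n] [DecidableEq n]
    (P C : Matrix n n ℂ) (c : ℂ) (hC : C.det ≠ 0) :
    (1 + c • (P * C⁻¹)).det = (C + c • P).det / C.det := by
  rw [eq_div_iff hC, ← det_mul, add_mul, one_mul, smul_mul_assoc, Matrix.mul_assoc,
    nonsing_inv_mul _ (isUnit_iff_ne_zero.mpr hC), Matrix.mul_one]

/-- `det (1 + c P C⁻¹)` is positive for `P` positive semidefinite, `C` positive definite, `0 ≤ c`. -/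
theorem det_one_add_smul_mul_inv_pos {n : Type*} [Fintype n] [DecidableEq n]
    {P C : Matrix n n ℂ} {c : ℂ} (hP : P.PosSemidef) (hC : C.PosDef) (hc : 0 ≤ c) :
    0 < (1 + c • (P * C⁻¹)).det := by
  rw [det_one_add_smul_mul_inv P C c hC.det_pos.ne']
  exact div_pos (hC.add_posSemidef (hP.smul hc)).det_pos hC.det_pos

/-- asymptotic evaluation of the dual channel matching rate, Theorem 2.
If `A_K → a • I_M` entrywise with `a > 0`, and `(B_K)` are Hermitian positive definite with
`B_K → θ • I_M` entrywise, `θ > 0`, then each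
`det(I_M + (K/M) A_K A_Kᴴ (B_K + (1/K) I_M)⁻¹)` is a positive real, and
`(1/2) log det(…) − (M/2) log K → (M/2) log (a² / (M θ))` as `K → ∞`. -/
theorem rate_dual_channel_matching_asymptotics {M : ℕ} (hM : 1 ≤ M)
    {a θ : ℝ} (ha : 0 < a) (hθ : 0 < θ)
    (A B : ℕ → Matrix (Fin M) (Fin M) ℂ)
    (hB : ∀ K, (B K).PosDef)
    (hAconv : ∀ i j, Tendsto (fun K => A K i j) atTop
      (𝓝 (((a : ℂ) • (1 : Matrix (Fin M) (Fin M) ℂ)) i j)))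
    (hBconv : ∀ i j, Tendsto (fun K => B K i j) atTop
      (𝓝 (((θ : ℂ) • (1 : Matrix (Fin M) (Fin M) ℂ)) i j))) :
    (∀ K : ℕ,
      0 < ((1 + ((K : ℂ) / (M : ℂ)) •
          (A K * (A K)ᴴ * (B K + (1 / (K : ℂ)) • 1)⁻¹)).det).re ∧
      ((1 + ((K : ℂ) / (M : ℂ)) •
          (A K * (A K)ᴴ * (B K + (1 / (K : ℂ)) • 1)⁻¹)).det).im = 0) ∧
    Tendsto (fun K : ℕ =>
        (1 / 2 : ℝ) * Real.log ((1 + ((K : ℂ) / (M : ℂ)) •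
          (A K * (A K)ᴴ * (B K + (1 / (K : ℂ)) • 1)⁻¹)).det).re
        - (M / 2 : ℝ) * Real.log K)
      atTop (𝓝 ((M / 2 : ℝ) * Real.log (a ^ 2 / (M * θ)))) := by
  have hC : ∀ K : ℕ, (B K + (1 / (K : ℂ)) • 1).PosDef := fun K =>
    (hB K).add_posSemidef (PosSemidef.one.smul (by positivity))
  have hpos : ∀ K : ℕ, 0 < (1 + ((K : ℂ) / (M : ℂ)) •
      (A K * (A K)ᴴ * (B K + (1 / (K : ℂ)) • 1)⁻¹)).det := fun K =>
    det_one_add_smul_mul_inv_pos (posSemidef_self_mul_conjTranspose (A K)) (hC K) (by positivity)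
  have hre : ∀ K : ℕ, 0 < ((1 + ((K : ℂ) / (M : ℂ)) •
      (A K * (A K)ᴴ * (B K + (1 / (K : ℂ)) • 1)⁻¹)).det).re := fun K =>
    (Complex.lt_def.mp (hpos K)).1
  refine ⟨fun K => ⟨hre K, (Complex.lt_def.mp (hpos K)).2.symm⟩, ?_⟩
  have hM0 : (M : ℝ) ≠ 0 := by positivity
  have hA : Tendsto A atTop (𝓝 ((a : ℂ) • 1)) :=
    tendsto_pi_nhds.mpr fun i => tendsto_pi_nhds.mpr (hAconv i)
  have hB' : Tendsto B atTop (𝓝 ((θ : ℂ) • 1)) :=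
    tendsto_pi_nhds.mpr fun i => tendsto_pi_nhds.mpr (hBconv i)
  have hinv : Tendsto (fun K : ℕ => 1 / (K : ℂ)) atTop (𝓝 0) :=
    tendsto_one_div_atTop_nhds_zero_nat
  have hCt : Tendsto (fun K : ℕ => B K + (1 / (K : ℂ)) • (1 : Matrix (Fin M) (Fin M) ℂ)) atTop
      (𝓝 ((θ : ℂ) • 1)) := by
    simpa using hB'.add (hinv.smul_const (1 : Matrix (Fin M) (Fin M) ℂ))
  have hAA : Tendsto (fun K => A K * (A K)ᴴ) atTop
      (𝓝 (((a : ℂ) • (1 : Matrix (Fin M) (Fin M) ℂ)) * ((a : ℂ) • 1)ᴴ)) :=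
    ((continuous_id.matrix_mul continuous_id.matrix_conjTranspose).tendsto _).comp hA
  have hnum : Tendsto (fun K : ℕ => (1 / (K : ℂ)) • (B K + (1 / (K : ℂ)) • 1) +
      (1 / (M : ℂ)) • (A K * (A K)ᴴ)) atTop
      (𝓝 (((a ^ 2 / M : ℝ) : ℂ) • (1 : Matrix (Fin M) (Fin M) ℂ))) := by
    convert (hinv.smul hCt).add (hAA.const_smul (1 / (M : ℂ))) using 2
    simp only [conjTranspose_smul, conjTranspose_one, smul_mul_smul_comm, mul_one, smul_smul,
      Complex.star_def, Complex.conj_ofReal, ← add_smul]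
    congr 1
    push_cast
    ring
  have hq : Tendsto (fun K : ℕ => (((1 / (K : ℂ)) • (B K + (1 / (K : ℂ)) • 1) +
      (1 / (M : ℂ)) • (A K * (A K)ᴴ)).det / (B K + (1 / (K : ℂ)) • 1).det).re) atTop
      (𝓝 ((a ^ 2 / (M * θ)) ^ M)) := by
    have hdet := (((continuous_id (X := Matrix (Fin M) (Fin M) ℂ)).matrix_det.tendsto _).comp
      hnum).div (((continuous_id (X := Matrix (Fin M) (Fin M) ℂ)).matrix_det.tendsto _).comp hCt)
      (by simp [hθ.ne'])
    have h := (Complex.continuous_re.tendsto _).comp hdet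
    convert h using 2
    · rfl
    simp only [id, det_smul, det_one, mul_one, Fintype.card_fin]
    rw [← div_pow, ← Complex.ofReal_div, ← Complex.ofReal_pow, Complex.ofReal_re, div_div]
  have hlog := (hq.log (by positivity)).const_mul (1 / 2 : ℝ)
  rw [Real.log_pow] at hlog
  have hval : (M / 2 : ℝ) * Real.log (a ^ 2 / (M * θ)) =
      1 / 2 * (M * Real.log (a ^ 2 / (M * θ))) := by ring
  rw [hval]
  refine hlog.congr' ?_
  filter_upwards [eventually_gt_atTop 0] with K hK
  have hKC : (K : ℂ) ≠ 0 := by exact_mod_cast hK.ne'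
  have hKR : (K : ℝ) ≠ 0 := by exact_mod_cast hK.ne'
  have hscale : (1 + ((K : ℂ) / (M : ℂ)) •
      (A K * (A K)ᴴ * (B K + (1 / (K : ℂ)) • 1)⁻¹)).det = ((K ^ M : ℝ) : ℂ) *
      (((1 / (K : ℂ)) • (B K + (1 / (K : ℂ)) • 1) +
      (1 / (M : ℂ)) • (A K * (A K)ᴴ)).det / (B K + (1 / (K : ℂ)) • 1).det) := by
    rw [det_one_add_smul_mul_inv _ _ _ (hC K).det_pos.ne', ← mul_div_assoc]
    congr 1
    have h := det_smul ((1 / (K : ℂ)) • (B K + (1 / (K : ℂ)) • 1) +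
      (1 / (M : ℂ)) • (A K * (A K)ᴴ)) (K : ℂ)
    rw [Fintype.card_fin] at h
    push_cast
    rw [← h, smul_add, smul_smul, smul_smul, mul_one_div_cancel hKC, one_smul, mul_one_div]
  have hp := hre K
  rw [hscale, Complex.re_ofReal_mul] at hp ⊢
  rw [Real.log_mul (pow_ne_zero _ hKR) (right_ne_zero_of_mul hp.ne'), Real.log_pow]
  ring
end
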